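/- arXiv:2603.22884 — 3 statements merged into one kernel-verified Lean document; each statement's English description precedes it below -/
import Mathlib

section
/- For any tree T of order n(T) ≥ 2, the total outer-independent domination number of the subdivision graph of T satisfies γ_t^{oi}(S(T)) ≥ (4n(T) − l(T) − s(T))/3. -/
open SimpleGraph

universe u

/-- A total outer-independent dominating set: every vertex has a neighbor in `D`,
and the complement of `D` is an independent set. -/
def IsTOIDS {V : Type u} (G : SimpleGraph V) (D : Set V) : Prop :=
  (∀ v : V, ∃ u ∈ D, G.Adj v u) ∧ ∀ u ∉ D, ∀ w ∉ D, ¬ G.Adj u w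

/-- The total outer-independent domination number. -/
noncomputable def toidNumber {V : Type u} (G : SimpleGraph V) : ℕ :=
  sInf {n : ℕ | ∃ D : Set V, IsTOIDS G D ∧ D.ncard = n}

/-- The subdivision graph: each edge is replaced by a new vertex adjacent exactly to
its two endpoints. -/
def subdivision {V : Type u} (G : SimpleGraph V) : SimpleGraph (V ⊕ G.edgeSet) :=
  SimpleGraph.fromRel fun x y =>
    ∃ (v : V) (e : G.edgeSet), x = Sum.inl v ∧ y = Sum.inr e ∧ v ∈ (e : Sym2 V)

/-- A leaf: a vertex with exactly one neighbor. -/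
def IsLeafVert {V : Type u} (G : SimpleGraph V) (v : V) : Prop := ∃! u, G.Adj v u

/-- A support vertex: a vertex adjacent to a leaf. -/
def IsSupportVert {V : Type u} (G : SimpleGraph V) (v : V) : Prop :=
  ∃ u, G.Adj v u ∧ IsLeafVert G u

/-- A strong support vertex: a vertex adjacent to at least two leaves. -/
def IsStrongSupportVert {V : Type u} (G : SimpleGraph V) (v : V) : Prop :=
  ∃ u w, u ≠ w ∧ G.Adj v u ∧ G.Adj v w ∧ IsLeafVert G u ∧ IsLeafVert G w

/-- A strong leaf: a leaf adjacent to a strong support vertex. -/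
def IsStrongLeaf {V : Type u} (G : SimpleGraph V) (v : V) : Prop :=
  IsLeafVert G v ∧ ∃ u, G.Adj v u ∧ IsStrongSupportVert G u

/-- A weak leaf: a leaf that is not a strong leaf. -/
def IsWeakLeaf {V : Type u} (G : SimpleGraph V) (v : V) : Prop :=
  IsLeafVert G v ∧ ¬ IsStrongLeaf G v

/-- A semi-support vertex: neither a leaf nor a support vertex, but adjacent to a
support vertex. -/
def IsSemiSupportVert {V : Type u} (G : SimpleGraph V) (v : V) : Prop :=
  ¬ IsLeafVert G v ∧ ¬ IsSupportVert G v ∧ ∃ u, G.Adj v u ∧ IsSupportVert G u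

/-- The number of leaves, with the convention that `P₂` has exactly one leaf. -/
noncomputable def leafCount {V : Type u} (G : SimpleGraph V) : ℕ :=
  if Nat.card V = 2 then 1 else {v | IsLeafVert G v}.ncard

/-- The number of support vertices, with the convention that `P₂` has exactly one
support vertex. -/
noncomputable def supportCount {V : Type u} (G : SimpleGraph V) : ℕ :=
  if Nat.card V = 2 then 1 else {v | IsSupportVert G v}.ncard

/-- The graph obtained from `G` by attaching a path `P_r` to the vertex `v`:
the new vertices form a path `p₀ p₁ ⋯ p_{r-1}` and `v` is joined to the end `p₀`. -/
def attachPath {V : Type u} (G : SimpleGraph V) (v : V) (r : ℕ) :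
    SimpleGraph (V ⊕ Fin r) :=
  SimpleGraph.fromRel fun x y =>
    (∃ a b, x = Sum.inl a ∧ y = Sum.inl b ∧ G.Adj a b) ∨
    (∃ i j : Fin r, x = Sum.inr i ∧ y = Sum.inr j ∧ (j : ℕ) = (i : ℕ) + 1) ∨
    (∃ i : Fin r, x = Sum.inl v ∧ y = Sum.inr i ∧ (i : ℕ) = 0)

/-- The graph obtained from `G` by adding a disjoint copy of the tree `Q_r`
(`r` paths `P₃` joined to a central vertex) and identifying the central vertex
of `Q_r` with the vertex `v` of `G`. -/
def attachQ {V : Type u} (G : SimpleGraph V) (v : V) (r : ℕ) :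
    SimpleGraph (V ⊕ Fin r × Fin 3) :=
  SimpleGraph.fromRel fun x y =>
    (∃ a b, x = Sum.inl a ∧ y = Sum.inl b ∧ G.Adj a b) ∨
    (∃ i : Fin r, x = Sum.inl v ∧ y = Sum.inr (i, 0)) ∨
    (∃ (i : Fin r) (j k : Fin 3),
      x = Sum.inr (i, j) ∧ y = Sum.inr (i, k) ∧ (k : ℕ) = (j : ℕ) + 1)

/-- The family `F`: all trees obtainable from `P₂` by repeatedly
(F1) attaching `P₁` to a support vertex, (F2) attaching `P₂` to a support or
semi-support vertex, (F3) attaching `P₃` to a weak leaf. -/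
inductive InFamilyF : {W : Type u} → SimpleGraph W → Prop
  | base {W : Type u} (G : SimpleGraph W) (e : G ≃g SimpleGraph.pathGraph 2) :
      InFamilyF G
  | op1 {W : Type u} {G' : SimpleGraph W} {v : W} (hv : IsSupportVert G' v)
      (hF : InFamilyF G') {U : Type u} (G : SimpleGraph U)
      (e : G ≃g attachPath G' v 1) : InFamilyF G
  | op2 {W : Type u} {G' : SimpleGraph W} {v : W}
      (hv : IsSupportVert G' v ∨ IsSemiSupportVert G' v)
      (hF : InFamilyF G') {U : Type u} (G : SimpleGraph U)
      (e : G ≃g attachPath G' v 2) : InFamilyF G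
  | op3 {W : Type u} {G' : SimpleGraph W} {v : W} (hv : IsWeakLeaf G' v)
      (hF : InFamilyF G') {U : Type u} (G : SimpleGraph U)
      (e : G ≃g attachPath G' v 3) : InFamilyF G

/-- The family `𝒯`: all trees obtainable from `P₂` by repeatedly
(O1) attaching `P₁` to a support vertex, (O2) attaching `P₃` to a support vertex or a
weak leaf, (O3) adding a copy of `Q_r` (`r ≥ 2`) identifying its central vertex with a
weak leaf. -/
inductive InFamilyT : {W : Type u} → SimpleGraph W → Prop
  | base {W : Type u} (G : SimpleGraph W) (e : G ≃g SimpleGraph.pathGraph 2) :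
      InFamilyT G
  | op1 {W : Type u} {G' : SimpleGraph W} {v : W} (hv : IsSupportVert G' v)
      (hF : InFamilyT G') {U : Type u} (G : SimpleGraph U)
      (e : G ≃g attachPath G' v 1) : InFamilyT G
  | op2 {W : Type u} {G' : SimpleGraph W} {v : W}
      (hv : IsSupportVert G' v ∨ IsWeakLeaf G' v)
      (hF : InFamilyT G') {U : Type u} (G : SimpleGraph U)
      (e : G ≃g attachPath G' v 3) : InFamilyT G
  | op3 {W : Type u} {G' : SimpleGraph W} {v : W} (hv : IsWeakLeaf G' v)
      (hF : InFamilyT G') {r : ℕ} (hr : 2 ≤ r) {U : Type u} (G : SimpleGraph U)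
      (e : G ≃g attachQ G' v r) : InFamilyT G

theorem subdivision_adj_inl_inr {V : Type u} (G : SimpleGraph V) (v : V) (e : G.edgeSet) :
    (subdivision G).Adj (Sum.inl v) (Sum.inr e) ↔ v ∈ (e : Sym2 V) := by
  simp [subdivision]

theorem not_subdivision_adj_inl_inl {V : Type u} (G : SimpleGraph V) (v w : V) :
    ¬ (subdivision G).Adj (Sum.inl v) (Sum.inl w) := by
  simp [subdivision]

theorem not_subdivision_adj_inr_inr {V : Type u} (G : SimpleGraph V) (e f : G.edgeSet) :
    ¬ (subdivision G).Adj (Sum.inr e) (Sum.inr f) := by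
  simp [subdivision]

theorem exists_isTOIDS_ncard_eq_toidNumber {V : Type u} (G : SimpleGraph V)
    (hG : ∀ v, ∃ u, G.Adj v u) : ∃ D : Set V, IsTOIDS G D ∧ D.ncard = toidNumber G :=
  Nat.sInf_mem (s := {n : ℕ | ∃ D : Set V, IsTOIDS G D ∧ D.ncard = n})
    ⟨_, Set.univ, ⟨fun v => by simpa using hG v, by simp⟩, rfl⟩

/-- If every vertex outside `R` is joined to `R` by an edge of `B`, then choosing such an edge
for each vertex outside `R` is injective. -/
theorem card_le_card_add_card_of_forall_exists_mem {V : Type u} [Fintype V]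
    (R : Finset V) (B : Finset (Sym2 V)) (h : ∀ v ∉ R, ∃ w ∈ R, s(v, w) ∈ B) :
    Fintype.card V ≤ R.card + B.card := by
  classical
  choose! f hfR hfB using h
  have hinj : Set.InjOn (fun v => s(v, f v)) (Rᶜ : Finset V) := by
    intro v hv w hw hvw
    simp only [Finset.coe_compl, Set.mem_compl_iff, Finset.mem_coe] at hv hw
    rcases Sym2.eq_iff.1 hvw with ⟨h, -⟩ | ⟨h, -⟩
    · exact h
    · exact absurd (h ▸ hfR w hw) hv
  have := Finset.card_le_card_of_injOn (t := B) _
    (fun v hv => hfB v (by simpa using hv)) hinj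
  have := Finset.card_add_card_compl R
  omega

open Classical in
/-- For an independent set `U` whose incident edges all lie in an edge cover `B`: count the edges
of `B` avoiding `U`, one edge at each vertex of `U`, and a second one at each non-leaf of `U`. -/
theorem card_filter_add_card_add_card_filter_le {V : Type u}
    (G : SimpleGraph V) (U : Finset V) (B : Finset (Sym2 V))
    (hG : ∀ v, ∃ w, G.Adj v w)
    (hU : ∀ x ∈ U, ∀ y, G.Adj x y → y ∉ U ∧ s(x, y) ∈ B) :
    (B.filter fun e => ∀ x ∈ e, x ∉ U).card + U.card + (U.filter fun x => ¬ IsLeafVert G x).card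
      ≤ B.card := by
  choose p hp using hG
  have hq : ∀ x, ¬ IsLeafVert G x → ∃ y, G.Adj x y ∧ y ≠ p x := by
    intro x hx
    by_contra! h
    exact hx ⟨p x, hp x, h⟩
  choose! q hq hqp using hq
  have key : ∀ f : V → V, ∀ W ⊆ U, (∀ x ∈ W, G.Adj x (f x)) →
      (W.image fun x => s(x, f x)).card = W.card := by
    intro f W hW hf
    refine Finset.card_image_of_injOn fun x hx y hy hxy => ?_
    rcases Sym2.eq_iff.1 hxy with ⟨h, -⟩ | ⟨h, -⟩
    · exact h
    · exact absurd (hW hx) (h ▸ (hU y (hW hy) _ (hf y hy)).1)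
  have hqW : ∀ x ∈ U.filter fun x => ¬ IsLeafVert G x, G.Adj x (q x) :=
    fun x hx => hq x (Finset.mem_filter.1 hx).2
  rw [← key p U subset_rfl fun x _ => hp x,
    ← key q (U.filter fun x => ¬ IsLeafVert G x) (Finset.filter_subset _ _) hqW,
    ← Finset.card_union_of_disjoint, ← Finset.card_union_of_disjoint]
  · refine Finset.card_le_card (Finset.union_subset (Finset.union_subset
      (Finset.filter_subset _ _) ?_) ?_)
    · exact Finset.image_subset_iff.2 fun x hx => (hU x hx _ (hp x)).2
    · exact Finset.image_subset_iff.2 fun x hx =>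
        (hU x (Finset.mem_filter.1 hx).1 _ (hqW x hx)).2
  · rw [Finset.disjoint_right]
    intro e he he'
    obtain ⟨x, hx, rfl⟩ := Finset.mem_image.1 he
    have hxU := (Finset.mem_filter.1 hx).1
    rcases Finset.mem_union.1 he' with he' | he'
    · exact (Finset.mem_filter.1 he').2 x (Sym2.mem_mk_left _ _) hxU
    · obtain ⟨y, hy, hxy⟩ := Finset.mem_image.1 he'
      rcases Sym2.eq_iff.1 hxy with ⟨rfl, h⟩ | ⟨rfl, h⟩
      · exact hqp y (Finset.mem_filter.1 hx).2 h.symm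
      · exact (hU x hxU _ (hqW x hx)).1 hy
  · rw [Finset.disjoint_right]
    intro e he he'
    obtain ⟨x, hx, rfl⟩ := Finset.mem_image.1 he
    exact (Finset.mem_filter.1 he').2 x (Sym2.mem_mk_left _ _) hx

theorem card_add_three_mul_card_le {V : Type u} [Fintype V] (G : SimpleGraph V)
    (U : Finset V) (B : Finset (Sym2 V)) (hB : ∀ e ∈ B, e ∈ G.edgeSet)
    (hcov : ∀ v, ∃ w, s(v, w) ∈ B)
    (hU : ∀ x ∈ U, ∀ y, G.Adj x y → y ∉ U ∧ s(x, y) ∈ B) :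
    Fintype.card V + 3 * U.card ≤
      3 * B.card + {v | IsLeafVert G v}.ncard + {v | IsSupportVert G v}.ncard := by
  classical
  have hadj : ∀ {v w}, s(v, w) ∈ B → G.Adj v w := fun h => hB _ h
  rw [Set.ncard_eq_toFinset_card', Set.ncard_eq_toFinset_card']
  set L := {v | IsLeafVert G v}.toFinset
  set S := {v | IsSupportVert G v}.toFinset with hS
  have h₂ : (U.filter fun x => IsLeafVert G x).card ≤ L.card :=
    Finset.card_le_card fun x hx => by simpa [L] using (Finset.mem_filter.1 hx).2
  have h₃ := Finset.card_filter_add_card_filter_not (s := U) (fun x => IsLeafVert G x)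
  set M := B.filter fun e => ∀ x ∈ e, x ∉ U with hM
  set N := U.filter fun x => ¬ IsLeafVert G x with hN
  have h₁ : M.card + U.card + N.card ≤ B.card := by
    convert card_filter_add_card_add_card_filter_le G U B
      (fun v => (hcov v).imp fun _ => hadj) hU
  have h₄ := card_le_card_add_card_of_forall_exists_mem
    (S ∪ N ∪ M.image fun e => (Quot.out e).1) B (by
      intro v hv
      obtain ⟨w, hw⟩ := hcov v
      refine ⟨w, ?_, hw⟩
      simp only [Finset.mem_union, not_or, hS, Set.mem_toFinset, Set.mem_ofPred_eq] at hv ⊢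
      obtain ⟨⟨hvS, hvN⟩, hvM⟩ := hv
      have hvw := hadj hw
      by_cases hvU : v ∈ U
      · have hvL : IsLeafVert G v := by simpa [hN, hvU] using hvN
        exact Or.inl (Or.inl ⟨v, hvw.symm, hvL⟩)
      by_cases hwU : w ∈ U
      · by_cases hwL : IsLeafVert G w
        · exact absurd ⟨w, hvw, hwL⟩ hvS
        · exact Or.inl (Or.inr (by simp [hN, hwU, hwL]))
      · have he : s(v, w) ∈ M := by simp [hM, hw, hvU, hwU]
        have hmem := Finset.mem_image_of_mem (fun e : Sym2 V => (Quot.out e).1) he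
        rcases Sym2.mem_iff.1 (Sym2.out_fst_mem s(v, w)) with h | h
        · exact absurd (h ▸ hmem) hvM
        · exact Or.inr (h ▸ hmem))
  have h₅ : (S ∪ N ∪ M.image fun e => (Quot.out e).1).card ≤ S.card + N.card + M.card :=
    (Finset.card_union_le _ _).trans
      (add_le_add (Finset.card_union_le _ _) Finset.card_image_le)
  omega

theorem lower_bound {V : Type u} [Fintype V] (T : SimpleGraph V)
    (hT : T.IsTree) (hn : 2 ≤ Nat.card V) :
    (4 * (Nat.card V : ℚ) - leafCount T - supportCount T) / 3 ≤ (toidNumber (subdivision T) : ℚ) := by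
  classical
  have : Nontrivial V := by
    rw [Nat.card_eq_fintype_card] at hn
    exact Fintype.one_lt_card_iff_nontrivial.1 hn
  have hadj : ∀ v, ∃ w, T.Adj v w := hT.connected.preconnected.exists_adj_of_nontrivial
  obtain ⟨D, ⟨hdom, hind⟩, hD⟩ := exists_isTOIDS_ncard_eq_toidNumber (subdivision T) (by
    rintro (v | ⟨⟨v, w⟩, e⟩)
    · obtain ⟨w, hw⟩ := hadj v
      exact ⟨Sum.inr ⟨s(v, w), hw⟩, (subdivision_adj_inl_inr ..).2 (Sym2.mem_mk_left _ _)⟩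
    · exact ⟨Sum.inl v, ((subdivision_adj_inl_inr ..).2 (Sym2.mem_mk_left _ _)).symm⟩)
  set A : Finset V := Finset.univ.filter fun v => Sum.inl v ∈ D with hA
  set B' : Finset T.edgeSet := Finset.univ.filter fun e => Sum.inr e ∈ D with hB'
  set B : Finset (Sym2 V) := B'.map (Function.Embedding.subtype _) with hB
  have hcard : D.ncard = A.card + B.card := by
    have : D = ((A.disjSum B' : Finset _) : Set (V ⊕ T.edgeSet)) := by
      ext (v | e) <;> simp [hA, hB']
    rw [this, Set.ncard_coe_finset, Finset.card_disjSum, hB, Finset.card_map]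
  have hmem : ∀ e : T.edgeSet, (e : Sym2 V) ∈ B ↔ Sum.inr e ∈ D := by
    simp [hB, hB']
  have hBT : ∀ e ∈ B, e ∈ T.edgeSet := by
    intro e he
    obtain ⟨f, -, rfl⟩ := Finset.mem_map.1 he
    exact f.2
  have hcov : ∀ v, ∃ w, s(v, w) ∈ B := by
    intro v
    obtain ⟨x | e, hx, hvx⟩ := hdom (Sum.inl v)
    · exact absurd hvx (not_subdivision_adj_inl_inl _ _ _)
    · obtain ⟨w, hw⟩ := Sym2.mem_iff_exists.1 ((subdivision_adj_inl_inr ..).1 hvx)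
      exact ⟨w, hw ▸ (hmem e).2 hx⟩
  have hA_cover : ∀ v w, T.Adj v w → v ∈ A ∨ w ∈ A := by
    intro v w hvw
    obtain ⟨x | e, hx, hvx⟩ := hdom (Sum.inr ⟨s(v, w), hvw⟩)
    · rcases Sym2.mem_iff.1 ((subdivision_adj_inl_inr ..).1 hvx.symm) with rfl | rfl
      · exact Or.inl (by simpa [hA] using hx)
      · exact Or.inr (by simpa [hA] using hx)
    · exact absurd hvx (not_subdivision_adj_inr_inr _ _ _)
  have hmain := card_add_three_mul_card_le T Aᶜ B hBT hcov (by
    intro x hx y hxy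
    rw [Finset.mem_compl] at hx
    refine ⟨by simpa using (hA_cover x y hxy).resolve_left hx, ?_⟩
    refine (hmem ⟨s(x, y), hxy⟩).2 (by_contra fun he => ?_)
    exact hind _ (by simpa [hA] using hx) _ he
      ((subdivision_adj_inl_inr ..).2 (Sym2.mem_mk_left _ _)))
  have hcompl := Finset.card_add_card_compl A
  suffices 4 * Nat.card V ≤ 3 * D.ncard + leafCount T + supportCount T by
    rw [← hD]
    have : (4 * Nat.card V : ℚ) ≤ 3 * D.ncard + leafCount T + supportCount T := by
      exact_mod_cast this
    linarith
  unfold leafCount supportCount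
  split_ifs with h2
  · obtain ⟨v⟩ := hT.connected.nonempty
    obtain ⟨w, hw⟩ := hcov v
    have hBpos : 0 < B.card := Finset.card_pos.2 ⟨_, hw⟩
    have hApos : 0 < A.card := by
      rcases hA_cover v w (hBT _ hw) with h | h <;> exact Finset.card_pos.2 ⟨_, h⟩
    omega
  · rw [Nat.card_eq_fintype_card]
    omega
end

section
/- For any tree T of order n(T) ≥ 2, the total outer-independent domination number of the subdivision graph of T satisfies γ_t^{oi}(S(T)) ≤ (4n(T) − l(T) + s(T) − 2)/3. -/
open SimpleGraph

universe u

/-- A vertex cover `A` and a set `F` covering all vertices by edges, such that `F` contains every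
edge with an endpoint outside `A`, give a total outer-independent dominating set of the
subdivision graph. -/
theorem toidNumber_subdivision_le {V : Type u} [Finite V] (G : SimpleGraph V)
    (A : Finset V) (F : Finset (Sym2 V))
    (hcov : ∀ v, ∃ u, G.Adj v u ∧ s(v, u) ∈ F)
    (hA : ∀ u v, G.Adj u v → u ∈ A ∨ v ∈ A)
    (hF : ∀ u v, G.Adj u v → u ∉ A → s(u, v) ∈ F) :
    toidNumber (subdivision G) ≤ A.card + F.card := by
  have adj_iff : ∀ (v : V) (e : G.edgeSet),
      (subdivision G).Adj (Sum.inl v) (Sum.inr e) ↔ v ∈ (e : Sym2 V) := by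
    intro v e
    simp [subdivision]
  have not_adj_inl : ∀ u v : V, ¬ (subdivision G).Adj (Sum.inl u) (Sum.inl v) := by
    intro u v
    simp [subdivision]
  have not_adj_inr : ∀ e f : G.edgeSet, ¬ (subdivision G).Adj (Sum.inr e) (Sum.inr f) := by
    intro e f
    simp [subdivision]
  let E : Set G.edgeSet := Subtype.val ⁻¹' (F : Set (Sym2 V))
  let D : Set (V ⊕ G.edgeSet) := Sum.inl '' (A : Set V) ∪ Sum.inr '' E
  have mem_inl : ∀ v, Sum.inl v ∈ D ↔ v ∈ A := by simp [D]
  have mem_inr : ∀ e : G.edgeSet, Sum.inr e ∈ D ↔ (e : Sym2 V) ∈ F := by simp [D, E]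
  have mem_of_incident : ∀ (v : V) (e : G.edgeSet), v ∉ A → v ∈ (e : Sym2 V) →
      (e : Sym2 V) ∈ F := by
    rintro v ⟨e, he⟩ hv hve
    obtain ⟨u, rfl⟩ := Sym2.mem_iff_exists.1 hve
    exact hF v u he hv
  have hD : IsTOIDS (subdivision G) D := by
    refine ⟨?_, ?_⟩
    · rintro (v | ⟨e, he⟩)
      · obtain ⟨u, hu, huF⟩ := hcov v
        exact ⟨Sum.inr ⟨s(v, u), hu⟩, (mem_inr _).2 huF, (adj_iff _ _).2 (Sym2.mem_mk_left v u)⟩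
      · induction e with
        | _ x y =>
          rcases hA x y he with h | h
          · exact ⟨Sum.inl x, (mem_inl _).2 h, ((adj_iff _ _).2 (Sym2.mem_mk_left x y)).symm⟩
          · exact ⟨Sum.inl y, (mem_inl _).2 h, ((adj_iff _ _).2 (Sym2.mem_mk_right x y)).symm⟩
    · rintro (v | e) hu (w | f) hw h
      · exact not_adj_inl _ _ h
      · exact hw ((mem_inr _).2 (mem_of_incident v f (fun hv => hu ((mem_inl _).2 hv))
          ((adj_iff _ _).1 h)))
      · exact hu ((mem_inr _).2 (mem_of_incident w e (fun hv => hw ((mem_inl _).2 hv))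
          ((adj_iff _ _).1 h.symm)))
      · exact not_adj_inr _ _ h
  have hE : E.ncard ≤ F.card := by
    rw [← Set.ncard_coe_finset F, ← Set.ncard_image_of_injective E Subtype.val_injective]
    exact Set.ncard_le_ncard (Set.image_preimage_subset _ _) F.finite_toSet
  calc toidNumber (subdivision G) ≤ D.ncard := Nat.sInf_le ⟨D, hD, rfl⟩
    _ ≤ (Sum.inl '' (A : Set V) : Set (V ⊕ G.edgeSet)).ncard
          + (Sum.inr '' E : Set (V ⊕ G.edgeSet)).ncard := Set.ncard_union_le _ _
    _ = A.card + E.ncard := by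
      rw [Set.ncard_image_of_injective _ Sum.inl_injective,
        Set.ncard_image_of_injective _ Sum.inr_injective, Set.ncard_coe_finset]
    _ ≤ A.card + F.card := by lia

/-- In a tree, two neighbors of `v` that are both closer to the root coincide. -/
theorem SimpleGraph.IsTree.eq_of_adj_of_dist_eq_add_one {V : Type u} {G : SimpleGraph V}
    (hG : G.IsTree) {r v w w' : V} (hw : G.Adj w v) (hw' : G.Adj w' v)
    (hd : G.dist r v = G.dist r w + 1) (hd' : G.dist r v = G.dist r w' + 1) : w = w' := by
  obtain ⟨p, hp⟩ := hG.connected.exists_walk_length_eq_dist r w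
  obtain ⟨q, hq⟩ := hG.connected.exists_walk_length_eq_dist r w'
  have hp' : (p.concat hw).IsPath := Walk.isPath_of_length_eq_dist _ (by simp [hp, hd])
  have hq' : (q.concat hw').IsPath := Walk.isPath_of_length_eq_dist _ (by simp [hq, hd'])
  have h := congrArg Walk.penultimate ((hG.existsUnique_path r v).unique hp' hq')
  simpa using h

/-- Every tree has a parent function towards a given root. -/
theorem SimpleGraph.IsTree.exists_parent {V : Type u} {G : SimpleGraph V}
    (hG : G.IsTree) (r : V) :
    ∃ p : V → V, (∀ v, v ≠ r → G.Adj v (p v) ∧ G.dist r v = G.dist r (p v) + 1) ∧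
      ∀ u v, G.Adj u v → (u ≠ r ∧ p u = v) ∨ (v ≠ r ∧ p v = u) := by
  have key : ∀ v, ∃ w, v ≠ r → G.Adj v w ∧ G.dist r v = G.dist r w + 1 := by
    intro v
    by_cases hv : v = r
    · exact ⟨v, fun h => absurd hv h⟩
    obtain ⟨q, hq⟩ := hG.connected.exists_walk_length_eq_dist v r
    cases q with
    | nil => exact absurd rfl hv
    | @cons _ w _ h q =>
      refine ⟨w, fun _ => ⟨h, ?_⟩⟩
      have h1 := dist_le q
      have h2 := hG.dist_eq_dist_add_one_of_adj r h
      rw [Walk.length_cons] at hq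
      rw [dist_comm] at hq h1
      lia
  choose p hp using key
  refine ⟨p, hp, fun u v huv => ?_⟩
  have parent_eq : ∀ {u v}, G.Adj u v → G.dist r u = G.dist r v + 1 → u ≠ r ∧ p u = v := by
    intro u v huv h
    have hu : u ≠ r := by
      rintro rfl
      simp at h
    exact ⟨hu, hG.eq_of_adj_of_dist_eq_add_one (hp u hu).1.symm huv.symm (hp u hu).2 h⟩
  rcases hG.dist_eq_dist_add_one_of_adj r huv with h | h
  · exact Or.inl (parent_eq huv h)
  · exact Or.inr (parent_eq huv.symm h)

/-- The bound for a tree with a set `L` of leaves and the set `S` of their neighbors, provided that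
`L` and `S` are disjoint and every leaf lies in one of them. -/
theorem three_mul_toidNumber_subdivision_le {V : Type u} [Fintype V] {T : SimpleGraph V}
    (hT : T.IsTree) (L S : Finset V) (hS₀ : S.Nonempty) (hLS : Disjoint L S)
    (hLleaf : ∀ l ∈ L, IsLeafVert T l) (hL : ∀ l ∈ L, ∀ u, T.Adj l u → u ∈ S)
    (hS : ∀ s ∈ S, ∃ l ∈ L, T.Adj s l)
    (hR : ∀ w, w ∉ L → w ∉ S → ¬ IsLeafVert T w) :
    3 * toidNumber (subdivision T) + L.card + 2 ≤ 4 * Fintype.card V + S.card := by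
  classical
  obtain ⟨r, hr⟩ := hS₀
  obtain ⟨p, hp, hedge⟩ := hT.exists_parent r
  have hrL : r ∉ L := fun h => Finset.disjoint_left.1 hLS h hr
  have parent_notMem : ∀ v, v ≠ r → p v ∉ L := by
    intro v hv hl
    have hne : p v ≠ r := fun h => hrL (h ▸ hl)
    have h := (hLleaf _ hl).unique (hp v hv).1.symm (hp _ hne).1
    have h1 := (hp v hv).2
    have h2 := (hp _ hne).2
    rw [← h] at h2
    lia
  have exists_child : ∀ w, w ∉ L → w ∉ S → ∃ v, v ≠ r ∧ v ∉ L ∧ p v = w := by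
    intro w hwL hwS
    have hwr : w ≠ r := fun h => hwS (h ▸ hr)
    by_contra! hcon
    refine hR w hwL hwS ⟨p w, (hp w hwr).1, fun u hu => ?_⟩
    rcases hedge w u hu with h | h
    · exact h.2.symm
    · exact absurd h.2 (hcon u h.1 fun hul => hwS (hL u hul w hu.symm))
  let A : ℕ → Finset V := fun j => {v | v ∈ S ∨ v ∉ L ∧ T.dist r v % 3 ≠ j}
  let F : ℕ → Finset V := fun j => {v | v ∈ L ∨ v ≠ r ∧ T.dist r v % 3 ≠ (j + 2) % 3}
  have bound : ∀ j < 3, toidNumber (subdivision T) ≤ (A j).card + (F j).card := by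
    intro j hj
    have hFr : ∀ v ∈ F j, v ≠ r := by
      intro v hv
      rcases (Finset.mem_filter.1 hv).2 with h | h
      · exact fun hvr => hrL (hvr ▸ h)
      · exact h.1
    refine (toidNumber_subdivision_le T (A j) ((F j).image fun v => s(v, p v)) ?_ ?_ ?_).trans
      (Nat.add_le_add_left Finset.card_image_le _)
    · have of_mem : ∀ v ∈ F j, ∃ u, T.Adj v u ∧ s(v, u) ∈ (F j).image fun v => s(v, p v) :=
        fun v hv => ⟨p v, (hp v (hFr v hv)).1, Finset.mem_image_of_mem _ hv⟩
      have of_child : ∀ v ∈ F j, ∃ u, T.Adj (p v) u ∧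
          s(p v, u) ∈ (F j).image fun v => s(v, p v) := by
        intro v hv
        refine ⟨v, (hp v (hFr v hv)).1.symm, ?_⟩
        rw [Sym2.eq_swap]
        exact Finset.mem_image_of_mem _ hv
      intro v
      by_cases hvF : v ∈ F j
      · exact of_mem v hvF
      have hvL : v ∉ L := fun h => hvF (by simp [F, h])
      by_cases hvS : v ∈ S
      · obtain ⟨l, hl, hvl⟩ := hS v hvS
        have hlF : l ∈ F j := by simp [F, hl]
        rcases hedge l v hvl.symm with h | h
        · exact h.2 ▸ of_child l hlF
        · exact absurd (h.2 ▸ hl) (parent_notMem v h.1)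
      · have hvr : v ≠ r := fun h => hvS (h ▸ hr)
        obtain ⟨c, hcr, hcL, rfl⟩ := exists_child v hvL hvS
        refine of_child c ?_
        have hd := (hp c hcr).2
        simp only [F, Finset.mem_filter, Finset.mem_univ, true_and, hvL, hvr, hcL, hcr, ne_eq,
          not_false_eq_true, false_or, not_not] at hvF ⊢
        lia
    · have parent : ∀ v, v ≠ r → v ∈ A j ∨ p v ∈ A j := by
        intro v hv
        have hd := (hp v hv).2
        have hpL := parent_notMem v hv
        by_cases hvL : v ∈ L
        · exact Or.inr (by simp [A, hL v hvL _ (hp v hv).1])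
        · simp only [A, Finset.mem_filter, Finset.mem_univ, true_and, hvL, hpL, not_false_eq_true]
          by_cases h : T.dist r v % 3 = j
          · right; right; lia
          · left; right; exact h
      intro u v huv
      rcases hedge u v huv with ⟨h, rfl⟩ | ⟨h, rfl⟩
      · exact parent u h
      · exact (parent v h).symm
    · intro u v huv hu
      simp only [A, Finset.mem_filter, Finset.mem_univ, true_and, not_or, not_and, ne_eq,
        not_not] at hu
      rcases hedge u v huv with ⟨h, rfl⟩ | ⟨h, rfl⟩
      · refine Finset.mem_image_of_mem (fun v => s(v, p v)) ?_
        by_cases huL : u ∈ L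
        · simp [F, huL]
        · have := hu.2 huL
          simp only [F, Finset.mem_filter, Finset.mem_univ, true_and]
          exact Or.inr ⟨h, by lia⟩
      · rw [Sym2.eq_swap]
        refine Finset.mem_image_of_mem (fun v => s(v, p v)) ?_
        have := hu.2 (parent_notMem v h)
        have hd := (hp v h).2
        simp only [F, Finset.mem_filter, Finset.mem_univ, true_and]
        exact Or.inr ⟨h, by lia⟩
  have count : (A 0).card + (F 0).card + (A 1).card + (F 1).card + (A 2).card + (F 2).card
      + L.card + 2 = 4 * Fintype.card V + S.card := by
    have hLc : L.card = ∑ v, if v ∈ L then 1 else 0 := by simp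
    have hSc : S.card = ∑ v, if v ∈ S then 1 else 0 := by simp
    have hVc : 4 * Fintype.card V = ∑ _v : V, 4 := by simp [mul_comm]
    simp only [A, F, Finset.card_filter]
    rw [hLc, hSc, hVc, show ∀ a : ℕ, a + 2 = a + ∑ v, if v = r then 2 else 0 by simp]
    simp only [← Finset.sum_add_distrib]
    refine Finset.sum_congr rfl fun v _ => ?_
    have h3 : T.dist r v % 3 < 3 := Nat.mod_lt _ (by norm_num)
    have hd : v ∈ L → v ∉ S := fun h => Finset.disjoint_left.1 hLS h
    by_cases hvr : v = r
    · subst hvr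
      simp [hr, hrL]
    · by_cases hvL : v ∈ L
      · simp [hvL, hd hvL, hvr]
      · by_cases hvS : v ∈ S <;> generalize T.dist r v % 3 = k at h3 <;> interval_cases k <;>
          simp [hvL, hvS, hvr]
  have h0 := bound 0 (by norm_num)
  have h1 := bound 1 (by norm_num)
  have h2 := bound 2 (by norm_num)
  lia

/-- A connected graph with two adjacent leaves has at most two vertices. -/
theorem SimpleGraph.Connected.card_le_two_of_adj_leaves {V : Type u} [Fintype V]
    {G : SimpleGraph V} (hG : G.Connected) {u v : V} (huv : G.Adj u v)
    (hu : IsLeafVert G u) (hv : IsLeafVert G v) : Fintype.card V ≤ 2 := by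
  classical
  have all : ∀ w, w = u ∨ w = v := by
    intro w
    have h := (reachable_iff_reflTransGen u w).1 (hG.preconnected u w)
    induction h with
    | refl => exact Or.inl rfl
    | tail _ hab ih =>
      rcases ih with rfl | rfl
      · exact Or.inr (hu.unique hab huv)
      · exact Or.inl (hv.unique hab huv.symm)
  calc Fintype.card V = (Finset.univ : Finset V).card := rfl
    _ ≤ ({u, v} : Finset V).card := Finset.card_le_card fun w _ => by simpa using all w
    _ ≤ 2 := Finset.card_le_two

theorem upper_bound {V : Type u} [Fintype V] (T : SimpleGraph V)
    (hT : T.IsTree) (hn : 2 ≤ Nat.card V) :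
    (toidNumber (subdivision T) : ℚ) ≤ (4 * (Nat.card V : ℚ) - leafCount T + supportCount T - 2) / 3 := by
  classical
  suffices h : 3 * toidNumber (subdivision T) + leafCount T + 2
      ≤ 4 * Nat.card V + supportCount T by
    have h' : (3 * toidNumber (subdivision T) + leafCount T + 2 : ℚ)
        ≤ 4 * Nat.card V + supportCount T := by exact_mod_cast h
    linarith
  rw [Nat.card_eq_fintype_card] at hn
  have : Nontrivial V := Fintype.one_lt_card_iff_nontrivial.1 hn
  obtain ⟨l, hl⟩ := hT.exists_vert_degree_one_of_nontrivial
  have hleaf : IsLeafVert T l := degree_eq_one_iff_existsUnique_adj.1 hl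
  obtain ⟨r, hlr, hr⟩ := hleaf
  unfold leafCount supportCount
  rw [Nat.card_eq_fintype_card]
  by_cases h2 : Fintype.card V = 2
  · have all : ∀ v, v = l ∨ v = r := by
      have h : ({l, r} : Finset V) = Finset.univ := by
        rw [← Finset.card_eq_iff_eq_univ, h2, Finset.card_pair hlr.ne]
      intro v
      have := Finset.mem_univ v
      rw [← h] at this
      simpa using this
    have h := three_mul_toidNumber_subdivision_le hT {l} {r} (by simp) (by simpa using hlr.ne)
      (by simpa using ⟨r, hlr, hr⟩) (by simpa using hr) (by simpa using hlr.symm)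
      (fun w hw hw' => by
        rcases all w with rfl | rfl <;> simp at hw hw')
    simpa [h2] using h
  · rw [if_neg h2, if_neg h2, Set.ncard_eq_toFinset_card', Set.ncard_eq_toFinset_card']
    refine three_mul_toidNumber_subdivision_le hT _ _ ⟨r, ?_⟩ ?_ ?_ ?_ ?_ ?_
    · simpa using ⟨l, hlr.symm, r, hlr, hr⟩
    · rw [Finset.disjoint_left]
      intro v hv hv'
      simp only [Set.mem_toFinset, Set.mem_ofPred_eq] at hv hv'
      obtain ⟨u, hvu, hu⟩ := hv'
      have := hT.connected.card_le_two_of_adj_leaves hvu hv hu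
      lia
    · simp
    · intro v hv u hvu
      simp only [Set.mem_toFinset, Set.mem_ofPred_eq] at hv ⊢
      exact ⟨v, hvu.symm, hv⟩
    · intro s hs
      simp only [Set.mem_toFinset, Set.mem_ofPred_eq] at hs
      obtain ⟨u, hsu, hu⟩ := hs
      exact ⟨u, by simpa using hu, hsu⟩
    · intro w hw _
      simpa using hw
end

section
/- For any tree T of order at least three, there exists a total outer-independent dominating set D of the subdivision graph S(T) of minimum cardinality (i.e., |D| = γ_t^{oi}(S(T))) such that every support vertex of T and every semi-support vertex of T (viewed as vertices of S(T)) belongs to D. -/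
open SimpleGraph

universe u

/-- A TOIDS of the subdivision consists of a vertex cover and an edge cover that jointly
meet every incident vertex-edge pair. -/
theorem isTOIDS_subdivision_iff {V : Type u} (G : SimpleGraph V) (D : Set (V ⊕ G.edgeSet)) :
    IsTOIDS (subdivision G) D ↔
      (∀ e : G.edgeSet, ∃ v ∈ (e : Sym2 V), Sum.inl v ∈ D) ∧
      (∀ v : V, ∃ e : G.edgeSet, v ∈ (e : Sym2 V) ∧ Sum.inr e ∈ D) ∧
      ∀ (v : V) (e : G.edgeSet), v ∈ (e : Sym2 V) → Sum.inl v ∈ D ∨ Sum.inr e ∈ D := by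
  constructor
  · rintro ⟨h, hi⟩
    refine ⟨fun e => ?_, fun v => ?_, fun v e hv => ?_⟩
    · obtain ⟨u | f, hu, ha⟩ := h (Sum.inr e)
      · exact ⟨u, (subdivision_adj_inl_inr G u e).1 ha.symm, hu⟩
      · exact absurd ha (not_subdivision_adj_inr_inr G e f)
    · obtain ⟨u | f, hu, ha⟩ := h (Sum.inl v)
      · exact absurd ha (not_subdivision_adj_inl_inl G v u)
      · exact ⟨f, (subdivision_adj_inl_inr G v f).1 ha, hu⟩
    · by_contra! hc
      exact hi _ hc.1 _ hc.2 ((subdivision_adj_inl_inr G v e).2 hv)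
  · rintro ⟨he, hv, hi⟩
    refine ⟨?_, ?_⟩
    · rintro (v | e)
      · obtain ⟨f, hf, hD⟩ := hv v
        exact ⟨_, hD, (subdivision_adj_inl_inr G v f).2 hf⟩
      · obtain ⟨u, hu, hD⟩ := he e
        exact ⟨_, hD, ((subdivision_adj_inl_inr G u e).2 hu).symm⟩
    · rintro (u | e) hu (w | f) hw ha
      · exact not_subdivision_adj_inl_inl G u w ha
      · exact (hi u f ((subdivision_adj_inl_inr G u f).1 ha)).elim hu hw
      · exact (hi w e ((subdivision_adj_inl_inr G w e).1 ha.symm)).elim hw hu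
      · exact not_subdivision_adj_inr_inr G e f ha

theorem IsLeafVert.edge_eq {V : Type u} {G : SimpleGraph V} {l : V} (hl : IsLeafVert G l)
    {e f : G.edgeSet} (he : l ∈ (e : Sym2 V)) (hf : l ∈ (f : Sym2 V)) : e = f := by
  obtain ⟨e, hE⟩ := e
  obtain ⟨f, hF⟩ := f
  obtain ⟨a, rfl⟩ := Sym2.mem_iff_exists.1 he
  obtain ⟨b, rfl⟩ := Sym2.mem_iff_exists.1 hf
  obtain rfl := hl.unique ((G.mem_edgeSet).1 hE) ((G.mem_edgeSet).1 hF)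
  rfl

/-- Leaves are not support vertices in a connected graph of order at least three. -/
theorem IsLeafVert.not_isSupportVert {V : Type u} [Finite V] {G : SimpleGraph V}
    (hG : G.Connected) (hn : 3 ≤ Nat.card V) {l : V} (hl : IsLeafVert G l) :
    ¬ IsSupportVert G l := by
  rintro ⟨s, hls, hs⟩
  have hmem : ∀ w, w ∈ ({l, s} : Set V) := by
    intro w
    have hw := (SimpleGraph.reachable_iff_reflTransGen l w).1 (hG.preconnected l w)
    induction hw with
    | refl => simp
    | tail _ hab ih =>
      rcases ih with rfl | rfl
      · exact Or.inr (hl.unique hab hls)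
      · exact Or.inl (hs.unique hab hls.symm)
  have h := Set.ncard_insert_le l {s}
  rw [Set.eq_univ_of_forall hmem, Set.ncard_univ, Set.ncard_singleton] at h
  omega

/-- In a TOIDS of the subdivision, a support vertex may replace an adjacent leaf. -/
theorem IsTOIDS.exchange_leaf {V : Type u} {G : SimpleGraph V} {D : Set (V ⊕ G.edgeSet)}
    (hD : IsTOIDS (subdivision G) D) {s l : V} (hsl : G.Adj s l) (hl : IsLeafVert G l) :
    IsTOIDS (subdivision G) (insert (Sum.inl s) (D \ {Sum.inl l})) := by
  rw [isTOIDS_subdivision_iff] at hD ⊢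
  obtain ⟨he, hv, hi⟩ := hD
  refine ⟨fun e => ?_, fun v => ?_, fun v e hve => ?_⟩
  · obtain ⟨v, hve, hvD⟩ := he e
    by_cases hvl : v = l
    · subst hvl
      have : e = ⟨s(s, v), hsl⟩ := hl.edge_eq hve (Sym2.mem_mk_right s v)
      exact ⟨s, by simp [this], by simp⟩
    · exact ⟨v, hve, by simp [hvD, hvl]⟩
  · obtain ⟨e, hve, heD⟩ := hv v
    exact ⟨e, hve, by simp [heD]⟩
  · by_cases hvl : v = l
    · subst hvl
      obtain ⟨f, hf, hfD⟩ := hv v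
      right
      simp [hl.edge_eq hve hf, hfD]
    · rcases hi v e hve with h | h
      · left
        simp [h, hvl]
      · right
        simp [h]

/-- In a TOIDS of the subdivision avoiding a non-leaf vertex `v`, the vertex `v` may
replace an edge joining it to a support vertex of the TOIDS. -/
theorem IsTOIDS.exchange_edge {V : Type u} {G : SimpleGraph V} {D : Set (V ⊕ G.edgeSet)}
    (hD : IsTOIDS (subdivision G) D) {u v : V} (hvu : G.Adj v u) (hu : IsSupportVert G u)
    (huD : Sum.inl u ∈ D) (hvD : Sum.inl v ∉ D) (hv : ¬ IsLeafVert G v) :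
    IsTOIDS (subdivision G) (insert (Sum.inl v) (D \ {Sum.inr ⟨s(v, u), hvu⟩})) := by
  rw [isTOIDS_subdivision_iff] at hD ⊢
  obtain ⟨hc, ha, hi⟩ := hD
  refine ⟨fun e => ?_, fun w => ?_, fun w e hwe => ?_⟩
  · obtain ⟨w, hwe, hwD⟩ := hc e
    exact ⟨w, hwe, by simp [hwD]⟩
  · obtain ⟨e, hwe, heD⟩ := ha w
    by_cases hev : e = ⟨s(v, u), hvu⟩
    · subst hev
      rcases Sym2.mem_iff.1 hwe with rfl | rfl
      · obtain ⟨x, hx, hxu⟩ : ∃ x, G.Adj w x ∧ x ≠ u := by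
          by_contra! h
          exact hv ⟨u, hvu, h⟩
        refine ⟨⟨s(w, x), hx⟩, Sym2.mem_mk_left w x, ?_⟩
        have := (hi w ⟨s(w, x), hx⟩ (Sym2.mem_mk_left w x)).resolve_left hvD
        refine Or.inr ⟨this, ?_⟩
        simpa [Subtype.ext_iff, hvu.ne] using hxu
      · obtain ⟨l, hl, hll⟩ := hu
        obtain ⟨f, hlf, hfD⟩ := ha l
        have hf : f = ⟨s(w, l), hl⟩ := hll.edge_eq hlf (Sym2.mem_mk_right w l)
        subst hf
        refine ⟨_, Sym2.mem_mk_left w l, Or.inr ⟨hfD, ?_⟩⟩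
        have hlv : l ≠ v := by
          rintro rfl
          exact hv hll
        simp [Subtype.ext_iff, hlv, hvu.ne']
    · exact ⟨e, hwe, by simp [heD, hev]⟩
  · by_cases hev : e = ⟨s(v, u), hvu⟩
    · subst hev
      left
      rcases Sym2.mem_iff.1 hwe with rfl | rfl
      · simp
      · simp [huD]
    · rcases hi w e hwe with h | h
      · left
        simp [h]
      · right
        simp [h, hev]

theorem exists_isTOIDS_subdivision {V : Type u} {G : SimpleGraph V}
    (h : ∀ v, ∃ w, G.Adj v w) : ∃ D, IsTOIDS (subdivision G) D := by
  refine ⟨Set.univ, (isTOIDS_subdivision_iff G _).2 ⟨fun e => ?_, fun v => ?_, by simp⟩⟩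
  · exact ⟨_, Sym2.out_fst_mem (e : Sym2 V), trivial⟩
  · obtain ⟨w, hw⟩ := h v
    exact ⟨⟨s(v, w), hw⟩, Sym2.mem_mk_left v w, trivial⟩

theorem exists_min_toids_containing_supports {V : Type u} [Fintype V]
    (T : SimpleGraph V) (hT : T.IsTree) (hn : 3 ≤ Nat.card V) :
    ∃ D : Set (V ⊕ T.edgeSet), IsTOIDS (subdivision T) D ∧
      D.ncard = toidNumber (subdivision T) ∧
      ∀ v : V, IsSupportVert T v ∨ IsSemiSupportVert T v → Sum.inl v ∈ D := by
  have hconn : T.Connected := hT.connected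
  have : Nontrivial V := Finite.one_lt_card_iff_nontrivial.1 (by omega)
  obtain ⟨D₀, hD₀⟩ := exists_isTOIDS_subdivision fun v =>
    hconn.preconnected.exists_adj_of_nontrivial v
  obtain ⟨D₁, hD₁, hcard₁⟩ :=
    Nat.sInf_mem (s := {n : ℕ | ∃ D : Set (V ⊕ T.edgeSet),
      IsTOIDS (subdivision T) D ∧ D.ncard = n}) ⟨_, D₀, hD₀, rfl⟩
  let S : Set (V ⊕ T.edgeSet) :=
    Sum.inl '' {v | IsSupportVert T v ∨ IsSemiSupportVert T v}
  obtain ⟨D, ⟨hD, hcard⟩, hmax⟩ := Set.exists_max_image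
    {D | IsTOIDS (subdivision T) D ∧ D.ncard = toidNumber (subdivision T)}
    (fun D => (D ∩ S).ncard) (Set.toFinite _) ⟨D₁, hD₁, hcard₁⟩
  have hexch : ∀ (v : V) (x : V ⊕ T.edgeSet),
      IsSupportVert T v ∨ IsSemiSupportVert T v → Sum.inl v ∉ D → x ∈ D → x ∉ S →
      ¬ IsTOIDS (subdivision T) (insert (Sum.inl v) (D \ {x})) := by
    intro v x hv hvD hxD hxS hD'
    have hvS : Sum.inl v ∈ S := ⟨v, hv, rfl⟩
    refine (hmax _ ⟨hD', (Set.ncard_exchange hvD hxD).trans hcard⟩).not_gt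
      (Set.ncard_lt_ncard ⟨?_, fun h => hvD (h ⟨Set.mem_insert _ _, hvS⟩).1⟩)
    rintro y ⟨hyD, hyS⟩
    exact ⟨Or.inr ⟨hyD, fun hyx => hxS (hyx ▸ hyS)⟩, hyS⟩
  have hsupp : ∀ v, IsSupportVert T v → Sum.inl v ∈ D := by
    intro v hv
    by_contra hvD
    obtain ⟨l, hvl, hl⟩ := hv
    have hlD : Sum.inl l ∈ D := by
      obtain ⟨w, hw, hwD⟩ := ((isTOIDS_subdivision_iff T D).1 hD).1 ⟨s(v, l), hvl⟩
      rcases Sym2.mem_iff.1 hw with rfl | rfl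
      · exact absurd hwD hvD
      · exact hwD
    refine hexch v (Sum.inl l) (Or.inl ⟨l, hvl, hl⟩) hvD hlD ?_ (hD.exchange_leaf hvl hl)
    rintro ⟨w, hw, h⟩
    obtain rfl := Sum.inl_injective h
    exact hw.elim (hl.not_isSupportVert hconn hn) fun h => h.1 hl
  refine ⟨D, hD, hcard, fun v hv => hv.elim (hsupp v) fun hsemi => ?_⟩
  by_contra hvD
  obtain ⟨hvl, -, u, hvu, hu⟩ := hsemi
  have heD := (((isTOIDS_subdivision_iff T D).1 hD).2.2 v ⟨s(v, u), hvu⟩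
    (Sym2.mem_mk_left v u)).resolve_left hvD
  refine hexch v _ hv hvD heD ?_ (hD.exchange_edge hvu hu (hsupp u hu) hvD hvl)
  rintro ⟨w, -, h⟩
  exact Sum.inl_ne_inr h
end
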